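/- LTL_NT is a proper subset of LTL: every formula valid in all models on all non-transitive linear frames is valid in all standard linear models, and there is a formula in LTL that is not in LTL_NT. -/

import Mathlib

/-- LTL formulas: letters, falsum, implication, Next, Until.
Other Boolean connectives are defined as abbreviations. -/
inductive Fml : Type
  | letter : ℕ → Fml
  | bot : Fml
  | imp : Fml → Fml → Fml
  | next : Fml → Fml
  | untl : Fml → Fml → Fml
deriving DecidableEq

namespace Fml
def neg (φ : Fml) : Fml := imp φ bot
def top : Fml := neg bot
def conj (φ ψ : Fml) : Fml := neg (imp φ (neg ψ))
def disj (φ ψ : Fml) : Fml := imp (neg φ) ψ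
/-- □φ abbreviates ¬(⊤ U ¬φ). -/
def box (φ : Fml) : Fml := neg (untl top (neg φ))
end Fml

/-- Truth in a model on the non-transitive linear frame determined by `t : ℕ → ℕ`:
`φ U ψ` at `a` looks only as far as `t a`. -/
def sat (t : ℕ → ℕ) (V : ℕ → Set ℕ) : Fml → ℕ → Prop
  | .letter p, a => a ∈ V p
  | .bot, _ => False
  | .imp φ ψ, a => sat t V φ a → sat t V ψ a
  | .next φ, a => sat t V φ (a + 1)
  | .untl φ ψ, a => ∃ b, a ≤ b ∧ b ≤ t a ∧ sat t V ψ b ∧ ∀ c, a ≤ c → c < b → sat t V φ c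

/-- A non-transitive linear frame: `t i > i` and `t` is increasing on successive points. -/
def NTFrame (t : ℕ → ℕ) : Prop := (∀ i, i < t i) ∧ (∀ i, t i < t (i + 1))

/-- The logic LTL_NT. -/
def LTLNT : Set Fml := {φ | ∀ t, NTFrame t → ∀ V a, sat t V φ a}

/-- Standard LTL semantics on ⟨ℕ, ≤, Next⟩. -/
def satStd (V : ℕ → Set ℕ) : Fml → ℕ → Prop
  | .letter p, a => a ∈ V p
  | .bot, _ => False
  | .imp φ ψ, a => satStd V φ a → satStd V ψ a
  | .next φ, a => satStd V φ (a + 1)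
  | .untl φ ψ, a => ∃ b, a ≤ b ∧ satStd V ψ b ∧ ∀ c, a ≤ c → c < b → satStd V φ c

/-- The standard linear temporal logic LTL. -/
def LTL : Set Fml := {φ | ∀ V a, satStd V φ a}

/-- The logic LTL_NT(m) of uniform intransitivity `m` (frame with `t i = i + m`). -/
def LTLNTm (m : ℕ) : Set Fml := {φ | ∀ V a, sat (· + m) V φ a}

/-- An inference rule: a finite list of premises and a conclusion. -/
structure Rule where
  prem : List Fml
  concl : Fml

/-- A rule is valid in a model iff truth of all premises at all points implies
truth of the conclusion at all points. -/
def validInModel (t : ℕ → ℕ) (V : ℕ → Set ℕ) (r : Rule) : Prop :=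
  (∀ φ ∈ r.prem, ∀ a, sat t V φ a) → ∀ a, sat t V r.concl a

/-- A rule is valid in a frame iff it is valid in every model on it. -/
def validInFrame (t : ℕ → ℕ) (r : Rule) : Prop := ∀ V, validInModel t V r

/-- Size of a formula. -/
def Fml.size : Fml → ℕ
  | .letter _ => 1
  | .bot => 1
  | .imp φ ψ => φ.size + ψ.size + 1
  | .next φ => φ.size + 1
  | .untl φ ψ => φ.size + ψ.size + 1

/-- Size of a rule. -/
def Rule.size (r : Rule) : ℕ := (r.prem.map Fml.size).sum + r.concl.size

/-- An injective encoding of formulas into ℕ (to speak about computability). -/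
def encF : Fml → ℕ
  | .letter p => Nat.pair 0 p
  | .bot => Nat.pair 1 0
  | .imp φ ψ => Nat.pair 2 (Nat.pair (encF φ) (encF ψ))
  | .next φ => Nat.pair 3 (encF φ)
  | .untl φ ψ => Nat.pair 4 (Nat.pair (encF φ) (encF ψ))

def encL : List Fml → ℕ
  | [] => 0
  | φ :: l => Nat.pair (encF φ) (encL l) + 1

/-- An injective encoding of rules into ℕ. -/
def encRule (r : Rule) : ℕ := Nat.pair (encL r.prem) (encF r.concl)

/-- A literal: `φ` or `¬φ` according to a Boolean flag (`α⁰ = α`, `α¹ = ¬α`). -/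
def lit (b : Bool) (φ : Fml) : Fml := if b then φ else φ.neg

/-- Conjunction of a list of formulas. -/
def bigConj : List Fml → Fml
  | [] => Fml.top
  | φ :: l => (bigConj l).conj φ

/-- Disjunction of a list of formulas. -/
def bigDisj : List Fml → Fml
  | [] => Fml.bot
  | φ :: l => (bigDisj l).disj φ

/-- The premise of a rule in reduced normal form: a disjunction over `j < l` of
conjunctions of literals over `xᵢ`, `N xᵢ` (for `i < n`) and `xᵢ U x_k` (for `i ≠ k`). -/
def rnfPremise (n l : ℕ) (t0 t1 : Fin l → Fin n → Bool)
    (t2 : Fin l → Fin n → Fin n → Bool) : Fml :=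
  bigDisj ((List.finRange l).map fun j =>
    bigConj ((List.finRange n).map (fun i => lit (t0 j i) (.letter i)) ++
      (List.finRange n).map (fun i => lit (t1 j i) (.next (.letter i))) ++
      ((List.finRange n).flatMap fun i =>
        ((List.finRange n).filter (fun k => k ≠ i)).map fun k =>
          lit (t2 j i k) (.untl (.letter i) (.letter k))))) 

/-- `IsRNF n l r`: the rule `r` is in reduced normal form with `n` letters and
`l` disjuncts, i.e. of the shape `ε / x₁`. -/
def IsRNF (n l : ℕ) (r : Rule) : Prop :=
  0 < n ∧ 0 < l ∧ r.concl = .letter 0 ∧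
    ∃ t0 t1 t2, r.prem = [rnfPremise n l t0 t1 t2]

/-- Next relation of the finite frame ℱ(N(r)): it wraps the last point `T` to `g`. -/
def wNext (T g : ℕ) (a : ℕ) : ℕ := if a = T then g else a + 1

/-- Truth in a model on the finite frame `ℱ(N(r))` obtained from the frame of `t`:
the base set is `[0, t^[r+1] 0]`, `T = t^[r+1] 0` is the last point, whose `Next` is
`G = t^[g] 0`; `until` from `a` follows `wNext` for at most `t a - a` steps, so on the
last interval it acts as if the interval following it were `[t^[g] 0, t^[g+1] 0]`. -/
def satFin (t : ℕ → ℕ) (T G : ℕ) (V : ℕ → Set ℕ) : Fml → ℕ → Prop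
  | .letter p, a => a ∈ V p
  | .bot, _ => False
  | .imp φ ψ, a => satFin t T G V φ a → satFin t T G V ψ a
  | .next φ, a => satFin t T G V φ (wNext T G a)
  | .untl φ ψ, a => ∃ k, k ≤ t a - a ∧ satFin t T G V ψ ((wNext T G)^[k] a) ∧
      ∀ j < k, satFin t T G V φ ((wNext T G)^[j] a)

/-- `r` is refuted by `V` in the finite frame `ℱ(N(rr))` (with parameter `g`) built
from the frame of `t`: all premises hold at every point of the frame, while the
conclusion fails at some point. -/
def refutedFin (t : ℕ → ℕ) (rr g : ℕ) (V : ℕ → Set ℕ) (r : Rule) : Prop :=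
  (∀ φ ∈ r.prem, ∀ a ≤ t^[rr + 1] 0, satFin t (t^[rr + 1] 0) (t^[g] 0) V φ a) ∧
    ∃ a ≤ t^[rr + 1] 0, ¬ satFin t (t^[rr + 1] 0) (t^[g] 0) V r.concl a

/-- Temporal degree: maximal nesting depth of `N` and `U`. -/
def tdeg : Fml → ℕ
  | .letter _ => 0
  | .bot => 0
  | .imp φ ψ => max (tdeg φ) (tdeg ψ)
  | .next φ => tdeg φ + 1
  | .untl φ ψ => max (tdeg φ) (tdeg ψ) + 1

/-- `i`-fold application of `N`. -/
def nPow : ℕ → Fml → Fml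
  | 0, φ => φ
  | k + 1, φ => .next (nPow k φ)

/-- Substitution of formulas for letters. -/
def subst (σ : ℕ → Fml) : Fml → Fml
  | .letter p => σ p
  | .bot => .bot
  | .imp φ ψ => .imp (subst σ φ) (subst σ ψ)
  | .next φ => .next (subst σ φ)
  | .untl φ ψ => .untl (subst σ φ) (subst σ ψ)

/-- A rule is admissible in a logic `L` iff every substitution making all premises
theorems of `L` makes the conclusion a theorem of `L`. -/
def Admissible (L : Set Fml) (r : Rule) : Prop :=
  ∀ σ : ℕ → Fml, (∀ φ ∈ r.prem, subst σ φ ∈ L) → subst σ r.concl ∈ L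

/-- For a fixed valuation, every sufficiently long frame agrees with the standard
semantics on a given formula. -/
theorem exists_bound (V : ℕ → Set ℕ) (φ : Fml) :
    ∃ t0 : ℕ → ℕ, ∀ t : ℕ → ℕ, (∀ i, t0 i ≤ t i) → ∀ a, sat t V φ a ↔ satStd V φ a := by
  classical
  induction φ with
  | letter p => exact ⟨fun _ => 0, fun t _ a => Iff.rfl⟩
  | bot => exact ⟨fun _ => 0, fun t _ a => Iff.rfl⟩
  | imp φ ψ ih1 ih2 =>
    obtain ⟨t1, h1⟩ := ih1
    obtain ⟨t2, h2⟩ := ih2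
    refine ⟨fun i => max (t1 i) (t2 i), fun t ht a => ?_⟩
    have e1 := h1 t (fun i => (le_max_left _ _).trans (ht i)) a
    have e2 := h2 t (fun i => (le_max_right _ _).trans (ht i)) a
    simp only [sat, satStd, e1, e2]
  | next φ ih =>
    obtain ⟨t1, h1⟩ := ih
    exact ⟨t1, fun t ht a => h1 t ht (a + 1)⟩
  | untl φ ψ ih1 ih2 =>
    obtain ⟨t1, h1⟩ := ih1
    obtain ⟨t2, h2⟩ := ih2
    have hw : ∀ a, ∃ w, satStd V (.untl φ ψ) a → ∃ b, a ≤ b ∧ b ≤ w ∧ satStd V ψ b ∧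
        ∀ c, a ≤ c → c < b → satStd V φ c := by
      intro a
      by_cases h : satStd V (.untl φ ψ) a
      · obtain ⟨b, hab, hb, hc⟩ := h
        exact ⟨b, fun _ => ⟨b, hab, le_rfl, hb, hc⟩⟩
      · exact ⟨0, fun h' => absurd h' h⟩
    choose w hw using hw
    refine ⟨fun i => max (max (t1 i) (t2 i)) (w i), fun t ht a => ?_⟩
    have e1 := h1 t (fun i => by have := ht i; simp only [] at this; omega)
    have e2 := h2 t (fun i => by have := ht i; simp only [] at this; omega)
    simp only [sat, e1, e2]
    constructor
    · rintro ⟨b, hab, _, hb, hc⟩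
      exact ⟨b, hab, hb, hc⟩
    · intro h
      obtain ⟨b, hab, hbw, hb, hc⟩ := hw a h
      exact ⟨b, hab, hbw.trans ((le_max_right _ _).trans (ht a)), hb, hc⟩

/-- LTL_NT is a proper subset of LTL. -/
theorem stmt13 :
    LTLNT ⊆ LTL ∧ ∃ φ : Fml, φ ∈ LTL ∧ φ ∉ LTLNT := by
  constructor
  · intro φ hφ V a
    obtain ⟨t0, h0⟩ := exists_bound V φ
    let t : ℕ → ℕ := fun i => i + 1 + ∑ j ∈ Finset.range (i + 1), t0 j
    have ht : NTFrame t := by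
      refine ⟨fun i => by simp only [t]; omega, fun i => ?_⟩
      simp only [t]
      rw [Finset.sum_range_succ _ (i + 1)]
      omega
    refine (h0 t (fun i => ?_) a).1 (hφ t ht V a)
    simp only [t]
    rw [Finset.sum_range_succ]
    omega
  · refine ⟨.imp (.untl .top (.untl .top (.letter 0))) (.untl .top (.letter 0)), ?_, ?_⟩
    · rintro V a ⟨b, hab, ⟨c, hbc, hc, _⟩, _⟩
      exact ⟨c, hab.trans hbc, hc, fun _ _ _ h => h⟩
    · intro h
      have h' := h (fun i => i + 1) ⟨fun i => Nat.lt_succ_self i, fun i => Nat.lt_succ_self _⟩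
        (fun _ => {2}) 0 ⟨1, by omega, le_rfl,
          ⟨2, by omega, le_rfl, rfl, fun _ _ _ h => h⟩, fun _ _ _ h => h⟩
      obtain ⟨b, _, hb, hb2, _⟩ := h'
      have hb3 : b = 2 := hb2
      simp only [] at hb
      omega
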